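/- If f(z) = z + Δ(z) with Δ(z) = a z^{q+1} + O(z^{q+2}), a ≠ 0, and ω_f is the Buff form of f, then the function u_f(z) = −1 + ∫_{[z,f(z)]} ω_f(s) ds, a priori defined off the fixed points, extends holomorphically to 0 with expansion u_f(z) = (1/12) a² q(q+1) z^{2q} + O(z^{2q+1}); in particular u_f has a zero of order exactly 2q at 0. -/

import Mathlib

open Complex Metric Filter Topology Set Asymptotics

lemma aux_derivO (R : ℂ → ℂ) (n : ℕ) (hR : AnalyticAt ℂ R 0)
    (h : R =O[𝓝 0] fun z => z^(n+1)) : deriv R =O[𝓝 0] fun z => z^n := by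
  have h1 : ∃ k : ℂ → ℂ, AnalyticAt ℂ k 0 ∧ ∀ᶠ z in 𝓝 0, R z = z^(n+1) * k z := by
    by_cases hk : ((n+1 : ℕ) : ℕ∞) ≤ analyticOrderAt R 0
    · rw [natCast_le_analyticOrderAt hR] at hk
      simpa using hk
    · exfalso
      push Not at hk
      obtain ⟨m, hm⟩ := ENat.ne_top_iff_exists.1 hk.ne_top
      rw [← hm] at hk
      have hk' : m < n + 1 := by exact_mod_cast hk
      obtain ⟨k, hka, hk0, hke⟩ := (hR.analyticOrderAt_eq_natCast).1 hm.symm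
      simp only [sub_zero, smul_eq_mul] at hke
      have h2 : (fun z => z^m * k z) =O[𝓝[≠] 0] fun z : ℂ => z^m * z^(n+1-m) := by
        refine ((h.congr' hke (Eventually.of_forall fun z => ?_)).mono nhdsWithin_le_nhds)
        simp only
        rw [← pow_add]; congr 1; omega
      have h3 : k =O[𝓝[≠] 0] fun z : ℂ => z^(n+1-m) := by
        obtain ⟨C, hC⟩ := h2.bound
        refine IsBigO.of_bound C ?_
        filter_upwards [hC, self_mem_nhdsWithin] with z hz hz0
        have : 0 < ‖z^m‖ := by simpa using pow_pos (norm_pos_iff.2 hz0) m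
        rw [norm_mul, norm_mul] at hz
        have : ‖z^m‖ * ‖k z‖ ≤ ‖z^m‖ * (C * ‖z^(n+1-m)‖) := by linarith
        exact le_of_mul_le_mul_left this ‹_›
      have h4 : Tendsto k (𝓝[≠] 0) (𝓝 0) := by
        refine h3.trans_tendsto ?_
        have : Tendsto (fun z : ℂ => z^(n+1-m)) (𝓝 0) (𝓝 (0^(n+1-m))) :=
          (continuous_pow _).tendsto _
        rw [zero_pow (by omega)] at this
        exact this.mono_left nhdsWithin_le_nhds
      exact hk0 (tendsto_nhds_unique (hka.continuousAt.tendsto.mono_left nhdsWithin_le_nhds) h4)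
  obtain ⟨k, hk, he⟩ := h1
  have h2 : deriv R =ᶠ[𝓝 0] fun z => z^n * ((n+1) * k z + z * deriv k z) := by
    filter_upwards [he.eventually_nhds, hk.eventually_analyticAt] with z hz hkz
    have : R =ᶠ[𝓝 z] fun z => z^(n+1) * k z := hz
    rw [this.deriv_eq]
    have := ((hasDerivAt_pow (n+1) z).mul hkz.differentiableAt.hasDerivAt).deriv
    refine Eq.trans this ?_
    push_cast
    ring_nf
    try simp
    try ring_nf
  have h3 : (fun z => (n+1) * k z + z * deriv k z) =O[𝓝 0] fun _ => (1:ℂ) := by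
    have := hk.continuousAt
    have := hk.deriv.continuousAt
    have h5 : ContinuousAt (fun z => (n+1) * k z + z * deriv k z) 0 := by fun_prop
    exact h5.tendsto.isBigO_one ℂ
  refine h2.trans_isBigO ?_
  simpa using (isBigO_refl (fun z : ℂ => z^n) (𝓝 0)).mul h3

lemma aux_mvt (φ φ' : ℂ → ℂ) (C δ : ℝ) (n : ℕ) (hC : 0 ≤ C)
    (h0 : φ 0 = 0) (hd : ∀ y, ‖y‖ < δ → HasDerivAt φ (φ' y) y)
    (hb : ∀ y, ‖y‖ < δ → ‖φ' y‖ ≤ C * ‖y‖^n) :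
    ∀ y, ‖y‖ < δ → ‖φ y‖ ≤ C * ‖y‖^(n+1) := by
  intro y hy
  have := (convex_closedBall (0:ℂ) ‖y‖).norm_image_sub_le_of_norm_hasDerivWithin_le
    (f := φ) (f' := φ') (C := C * ‖y‖^n) (x := 0) (y := y)
    (fun x hx => (hd x ?_).hasDerivWithinAt) (fun x hx => ?_) (by simp) (by simp)
  · rw [h0] at this
    simp only [sub_zero] at this
    rw [pow_succ, ← mul_assoc]; exact this
  · simp at hx; linarith
  · simp at hx
    refine (hb x (by linarith)).trans ?_
    gcongr

lemma aux_taylor (Δ : ℂ → ℂ) (h : AnalyticAt ℂ Δ 0) :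
    ∃ C δ : ℝ, 0 < δ ∧ ∀ x y : ℂ, ‖x‖ < δ → ‖y‖ < δ →
      ‖Δ (x+y) - Δ x - y * deriv Δ x - y^2/2 * deriv (deriv Δ) x‖ ≤ C * ‖y‖^3 ∧
      ‖deriv Δ (x+y) - deriv Δ x - y * deriv (deriv Δ) x‖ ≤ C * ‖y‖^2 := by
  have h3 : ∀ᶠ z in 𝓝 (0:ℂ), ‖deriv (deriv (deriv Δ)) z‖ ≤ ‖deriv (deriv (deriv Δ)) 0‖ + 1 := by
    have := h.deriv.deriv.deriv.continuousAt.norm.eventually_lt (continuousAt_const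
      (y := ‖deriv (deriv (deriv Δ)) 0‖ + 1)) (by linarith)
    exact this.mono fun _ h => h.le
  obtain ⟨ε, hε, hb⟩ := Metric.eventually_nhds_iff.1 (h3.and h.eventually_analyticAt)
  refine ⟨‖deriv (deriv (deriv Δ)) 0‖ + 1, ε/2, by linarith, ?_⟩
  intro x y hx hy
  have key : ∀ y : ℂ, ‖y‖ < ε/2 → dist (x+y) 0 < ε := by
    intro y hy
    rw [dist_zero_right]
    linarith [norm_add_le x y]
  have hC : 0 ≤ ‖deriv (deriv (deriv Δ)) 0‖ + 1 := by positivity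
  have s1 := aux_mvt (fun y => deriv (deriv Δ) (x+y) - deriv (deriv Δ) x)
    (fun y => deriv (deriv (deriv Δ)) (x+y)) _ (ε/2) 0 hC (by simp)
    (fun y hy => by
      have := (hb (key y hy)).2.deriv.deriv.differentiableAt.hasDerivAt
      simpa using (this.comp_const_add x y).sub_const (deriv (deriv Δ) x))
    (fun y hy => by simpa using (hb (key y hy)).1)
  have s2 := aux_mvt (fun y => deriv Δ (x+y) - deriv Δ x - y * deriv (deriv Δ) x) _
     _ (ε/2) 1 hC (by simp)
    (fun y hy => by
      have := (hb (key y hy)).2.deriv.differentiableAt.hasDerivAt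
      simpa [Pi.sub_def] using ((this.comp_const_add x y).sub_const (deriv Δ x)).sub
        ((hasDerivAt_id y).mul_const (deriv (deriv Δ) x)))
    (fun y hy => by simpa using (s1 y hy))
  have s3 := aux_mvt (fun y => Δ (x+y) - Δ x - y * deriv Δ x - y^2/2 * deriv (deriv Δ) x) 
     (fun y => deriv Δ (x+y) - deriv Δ x - y * deriv (deriv Δ) x)
     _ (ε/2) 2 hC (by simp)
    (fun y hy => by
      have := (hb (key y hy)).2.differentiableAt.hasDerivAt
      have h2 : HasDerivAt (fun y : ℂ => y^2/2) y y := by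
        simpa using (hasDerivAt_pow 2 y).div_const 2
      simpa [Pi.sub_def] using (((this.comp_const_add x y).sub_const (Δ x)).sub
        ((hasDerivAt_id y).mul_const (deriv Δ x))).sub (h2.mul_const (deriv (deriv Δ) x)))
    (fun y hy => by simpa using (s2 y hy))
  exact ⟨s3 y hy, s2 y hy⟩

lemma aux_param (W Δ : ℂ → ℂ) (U V : Set ℂ) (hU : IsOpen U) (hV : IsOpen V)
    (hW : DifferentiableOn ℂ W V) (hΔ : DifferentiableOn ℂ Δ U)
    (hmap : ∀ z ∈ U, ∀ t ∈ Icc (0:ℝ) 1, z + t * Δ z ∈ V) :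
    DifferentiableOn ℂ (fun z => ∫ t in (0:ℝ)..1, W (z + t * Δ z)) U := by
  intro z₀ hz₀
  have hs : ContinuousOn (fun x : ℂ × ℝ => x.1 + x.2 * Δ x.1) (U ×ˢ Icc 0 1) := by
    have h1 : ContinuousOn (fun x : ℂ × ℝ => Δ x.1) (U ×ˢ Icc 0 1) :=
      hΔ.continuousOn.comp continuousOn_fst (fun x hx => hx.1)
    exact continuousOn_fst.add ((Complex.continuous_ofReal.comp continuous_snd).continuousOn.mul h1)
  have hs' : MapsTo (fun x : ℂ × ℝ => x.1 + x.2 * Δ x.1) (U ×ˢ Icc 0 1) V :=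
    fun x hx => hmap x.1 hx.1 x.2 hx.2
  have hF : ContinuousOn (fun x : ℂ × ℝ => W (x.1 + x.2 * Δ x.1)) (U ×ˢ Icc 0 1) :=
    hW.continuousOn.comp hs hs'
  have hF' : ContinuousOn (fun x : ℂ × ℝ => deriv W (x.1 + x.2 * Δ x.1) * (1 + x.2 * deriv Δ x.1))
      (U ×ˢ Icc 0 1) := by
    have h1 : ContinuousOn (fun x : ℂ × ℝ => deriv Δ x.1) (U ×ˢ Icc 0 1) :=
      (hΔ.deriv hU).continuousOn.comp continuousOn_fst (fun x hx => hx.1)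
    have h2 : ContinuousOn (fun x : ℂ × ℝ => deriv W (x.1 + x.2 * Δ x.1)) (U ×ˢ Icc 0 1) :=
      (hW.deriv hV).continuousOn.comp hs hs'
    exact h2.mul (continuousOn_const.add
      ((Complex.continuous_ofReal.comp continuous_snd).continuousOn.mul h1))
  have slice : ∀ z ∈ U, MapsTo (fun t : ℝ => (z, t)) (Icc 0 1) (U ×ˢ Icc (0:ℝ) 1) :=
    fun z hz t ht => ⟨hz, ht⟩
  have hsl : ∀ z : ℂ, ContinuousOn (fun t : ℝ => (z, t)) (Icc 0 1) := fun z => by fun_prop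
  obtain ⟨ε, hε, hball⟩ := Metric.nhds_basis_closedBall.mem_iff.1 (hU.mem_nhds hz₀)
  have hK : IsCompact (closedBall z₀ ε ×ˢ Icc (0:ℝ) 1) :=
    (isCompact_closedBall _ _).prod isCompact_Icc
  obtain ⟨C, hC⟩ := hK.exists_bound_of_continuousOn
    (hF'.mono (prod_mono hball subset_rfl))
  have hsub : uIoc (0:ℝ) 1 ⊆ Icc 0 1 := by
    rw [uIoc_of_le zero_le_one]; exact Ioc_subset_Icc_self
  have := (intervalIntegral.hasDerivAt_integral_of_dominated_loc_of_deriv_le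
    (μ := MeasureTheory.volume) (a := 0) (b := 1)
    (F := fun z (t:ℝ) => W (z + t * Δ z))
    (F' := fun z (t:ℝ) => deriv W (z + t * Δ z) * (1 + t * deriv Δ z)) (x₀ := z₀)
    (s := closedBall z₀ ε) (bound := fun _ => C) (closedBall_mem_nhds _ hε) ?_ ?_ ?_ ?_ ?_ ?_).2
  · exact this.differentiableAt.differentiableWithinAt
  · filter_upwards [hU.mem_nhds hz₀] with z hz
    exact ((hF.comp (hsl z) (slice z hz)).mono hsub).aestronglyMeasurable measurableSet_uIoc
  · refine ContinuousOn.intervalIntegrable ?_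
    rw [uIcc_of_le zero_le_one]
    exact hF.comp (hsl z₀) (slice z₀ hz₀)
  · exact ((hF'.comp (hsl z₀) (slice z₀ hz₀)).mono hsub).aestronglyMeasurable measurableSet_uIoc
  · exact Eventually.of_forall fun t ht z hz => hC (z, t) ⟨hz, hsub ht⟩
  · simp
  · refine Eventually.of_forall fun t ht z hz => ?_
    have hzU := hball hz
    have h1 := (hΔ.differentiableAt (hU.mem_nhds hzU)).hasDerivAt
    have h2 := (hW.differentiableAt (hV.mem_nhds (hmap z hzU t (hsub ht)))).hasDerivAt
    exact h2.comp z ((hasDerivAt_id z).add (h1.const_mul (t:ℂ)))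

lemma aux_mono {α : Type*} {l : Filter α} {p c t : α → ℂ} (hp : p =O[l] (1 : α → ℂ))
    (hc : c =O[l] (1 : α → ℂ)) (ht : t =O[l] (1 : α → ℂ)) (k : ℂ) (i j m : ℕ) :
    (fun x => k * (p x^i * c x^j * t x^m)) =O[l] (1 : α → ℂ) := by
  have := (((hp.pow i).mul (hc.pow j)).mul (ht.pow m)).const_mul_left k
  simpa [Pi.one_def] using this

lemma aux_alg {α : Type*} {l : Filter α} (p c t w e A Y L : α → ℂ)
    (hw : Tendsto w l (𝓝 0)) (hwe : (fun x => w x^3) =O[l] e) (hew : e =O[l] fun x => w x^2)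
    (ht : t =O[l] (1 : α → ℂ)) (hp : p =O[l] w) (hc : c =O[l] fun x => w x^2)
    (hA : (fun x => A x - (1 + t x * p x + t x^2 * c x / 2)) =O[l] e)
    (hY : (fun x => Y x - (p x + t x * c x)) =O[l] e)
    (hL : (fun x => L x - (1 - Y x / 2 + Y x^2/3)) =O[l] fun x => Y x^3) :
    (fun x => (A x * L x)⁻¹ - (1 + (1/2 - t x) * p x + (t x^2 - t x/2 - 1/12) * p x^2
      + (t x/2 - t x^2/2) * c x)) =O[l] e := by
  have hw1 : w =O[l] (1 : α → ℂ) := hw.isBigO_one ℂ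
  have hww : (fun x => w x^2) =O[l] w := by
    simpa [pow_two] using (isBigO_refl w l).mul hw1
  have hp1 := hp.trans hw1
  have hcw := hc.trans hww
  have hc1 := hcw.trans hw1
  have he1 : e =O[l] (1 : α → ℂ) := (hew.trans hww).trans hw1
  have one : ∀ {F G : α → ℂ} {g : α → ℂ}, F =O[l] (1 : α → ℂ) → G =O[l] g →
      (fun x => F x * G x) =O[l] g := fun hF hG => by simpa using hF.mul hG
  have M := aux_mono hp1 hc1 ht
  -- Y bounds
  have htc : (fun x => t x * c x) =O[l] fun x => w x^2 := one ht hc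
  have hYp : (fun x => Y x - p x) =O[l] fun x => w x^2 := by
    have := (hY.trans hew).add htc
    refine this.congr_left fun x => ?_
    ring
  have hYw : Y =O[l] w := by
    refine ((hYp.trans hww).add hp).congr_left fun x => ?_
    ring
  have hY1 := hYw.trans hw1
  have hL0 : (fun x => L x - (1 - (p x + t x * c x)/2 + p x^2/3)) =O[l] e := by
    have h1 := hL.trans ((hYw.pow 3).trans hwe)
    have h2 := hY.const_mul_left (-1/2)
    have h3 : (fun x => (Y x - p x) * (Y x + p x)) =O[l] e := by
      refine (hYp.mul (hYw.add hp)).trans (hwe.congr_left fun x => ?_)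
      ring
    refine ((h1.add h2).add (h3.const_mul_left (1/3))).congr_left fun x => ?_
    ring
  set A0 : α → ℂ := fun x => 1 + t x * p x + t x^2 * c x / 2 with hA0
  set L0 : α → ℂ := fun x => 1 - (p x + t x * c x)/2 + p x^2/3 with hL0d
  set P : α → ℂ := fun x => 1 + (1/2 - t x) * p x + (t x^2 - t x/2 - 1/12) * p x^2
      + (t x/2 - t x^2/2) * c x with hP
  have bA0 : A0 =O[l] (1 : α → ℂ) := by
    refine (((M 1 0 0 0).add (M 1 1 0 1)).add (M (1/2) 0 1 2)).congr_left fun x => ?_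
    simp only [hA0]; ring
  have bL0 : L0 =O[l] (1 : α → ℂ) := by
    refine ((((M 1 0 0 0).add (M (-1/2) 1 0 0)).add (M (-1/2) 0 1 1)).add
      (M (1/3) 2 0 0)).congr_left fun x => ?_
    simp only [hL0d]; ring
  have bP : P =O[l] (1 : α → ℂ) := by
    refine ((((((((M 1 0 0 0).add (M (1/2) 1 0 0)).add (M (-1) 1 0 1)).add (M 1 2 0 2)).add
      (M (-1/2) 2 0 1)).add (M (-1/12) 2 0 0)).add (M (1/2) 0 1 1)).add
      (M (-1/2) 0 1 2)).congr_left fun x => ?_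
    simp only [hP]; ring
  have bL : L =O[l] (1 : α → ℂ) := by
    refine ((hL0.trans he1).add bL0).congr_left fun x => ?_
    ring
  have hmain : (fun x => 1 - A0 x * L0 x * P x) =O[l] e := by
    have c3 : (fun x => p x^3) =O[l] e := (hp.pow 3).trans hwe
    have cpc : (fun x => p x * c x) =O[l] e :=
      (hp.mul hc).trans (hwe.congr_left fun x => by ring)
    have cc : (fun x => c x * c x) =O[l] e :=
      (hcw.mul hc).trans (hwe.congr_left fun x => by ring)
    have q1 : (fun x => (-5/24)*(p x^0*c x^0*t x^0)
        + (1/12)*(p x^0*c x^0*t x^1)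
        + (1/2)*(p x^0*c x^0*t x^2)
        + (-1)*(p x^0*c x^0*t x^3)
        + (-5/16)*(p x^0*c x^1*t x^2)
        + (-1/24)*(p x^0*c x^1*t x^3)
        + (3/4)*(p x^0*c x^1*t x^4)
        + (1/36)*(p x^1*c x^0*t x^0)
        + (-1/24)*(p x^1*c x^0*t x^1)
        + (-1/4)*(p x^1*c x^0*t x^2)
        + (1/2)*(p x^1*c x^0*t x^3)
        + (1/72)*(p x^1*c x^1*t x^2)
        + (1/12)*(p x^1*c x^1*t x^3)
        + (-1/6)*(p x^1*c x^1*t x^4)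
        + (1/36)*(p x^2*c x^0*t x^1)
        + (1/6)*(p x^2*c x^0*t x^2)
        + (-1/3)*(p x^2*c x^0*t x^3)) =O[l] (1 : α → ℂ) := by
      repeat' first | exact M _ _ _ _ | apply IsBigO.add
    have q2 : (fun x => (1/2)*(p x^0*c x^0*t x^1)
        + (-3/4)*(p x^0*c x^0*t x^2)
        + (1)*(p x^0*c x^0*t x^3)
        + (1/2)*(p x^0*c x^1*t x^3)
        + (-5/8)*(p x^0*c x^1*t x^4)
        + (-5/24)*(p x^1*c x^0*t x^1)
        + (5/12)*(p x^1*c x^0*t x^2)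
        + (-1/4)*(p x^1*c x^0*t x^3)
        + (-1/2)*(p x^1*c x^0*t x^4)
        + (-5/48)*(p x^1*c x^1*t x^3)
        + (-1/24)*(p x^1*c x^1*t x^4)
        + (1/4)*(p x^1*c x^1*t x^5)) =O[l] (1 : α → ℂ) := by
      repeat' first | exact M _ _ _ _ | apply IsBigO.add
    have q3 : (fun x => (1/4)*(p x^0*c x^0*t x^2)
        + (-1/4)*(p x^0*c x^0*t x^3)
        + (1/4)*(p x^0*c x^0*t x^4)
        + (1/8)*(p x^0*c x^1*t x^4)
        + (-1/8)*(p x^0*c x^1*t x^5)) =O[l] (1 : α → ℂ) := by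
      repeat' first | exact M _ _ _ _ | apply IsBigO.add
    refine (((one q1 c3).add (one q2 cpc)).add (one q3 cc)).congr_left fun x => ?_
    simp only [hA0, hL0d, hP]
    ring
  have hMP : (fun x => 1 - A x * L x * P x) =O[l] e := by
    have h1 := one (one bL bP) hA
    have h2 := one (one bA0 bP) hL0
    refine ((hmain.sub h1).sub h2).congr_left fun x => ?_
    ring
  have he0 : Tendsto e l (𝓝 0) := (hew.trans hww).trans_tendsto hw
  have tp := hp.trans_tendsto hw
  have tc := hcw.trans_tendsto hw
  have tA : Tendsto A l (𝓝 1) := by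
    have h1 := hA.trans_tendsto he0
    have h2 := (one ht hp).trans_tendsto hw
    have h3 := (one (one ht ht) hcw).trans_tendsto hw
    have := ((h1.add h2).add (h3.div_const 2)).add_const 1
    simp only [zero_div, add_zero, zero_add] at this
    refine this.congr fun x => ?_
    ring
  have tL : Tendsto L l (𝓝 1) := by
    have h1 := hL0.trans_tendsto he0
    have h2 := (htc.trans hww).trans_tendsto hw
    have := (((h1.sub (tp.div_const 2)).sub (h2.div_const 2)).add ((tp.pow 2).div_const 3)).add_const 1
    norm_num at this
    refine this.congr fun x => ?_
    ring
  have tM : Tendsto (fun x => A x * L x) l (𝓝 1) := by simpa using tA.mul tL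
  have bM : (fun x => (A x * L x)⁻¹) =O[l] (1 : α → ℂ) := (tM.inv₀ one_ne_zero).isBigO_one ℂ
  refine (one bM hMP).congr' ?_ EventuallyEq.rfl
  filter_upwards [tM.eventually_ne one_ne_zero] with x hx
  change (A x * L x)⁻¹ * (1 - A x * L x * P x) = (A x * L x)⁻¹ - P x
  rw [mul_sub, ← mul_assoc, inv_mul_cancel₀ hx]
  ring

lemma aux_ne (g : ℂ → ℂ) (b : ℂ) (n : ℕ) (hb : b ≠ 0)
    (h : (fun z => g z - b * z^n) =O[𝓝 0] fun z => z^(n+1)) :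
    ∀ᶠ z in 𝓝[≠] (0:ℂ), g z ≠ 0 := by
  obtain ⟨C, hC⟩ := h.bound
  have h2 : ∀ᶠ z in 𝓝 (0:ℂ), C * ‖z‖ < ‖b‖ := by
    have : Tendsto (fun z : ℂ => C * ‖z‖) (𝓝 0) (𝓝 (C * ‖(0:ℂ)‖)) :=
      Continuous.tendsto (by fun_prop) _
    refine this.eventually_lt_const ?_
    simpa using hb
  filter_upwards [hC.filter_mono nhdsWithin_le_nhds, h2.filter_mono nhdsWithin_le_nhds,
    self_mem_nhdsWithin] with z h1 h2 h3 h0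
  rw [h0, zero_sub, norm_neg, norm_mul, norm_pow, norm_pow, pow_succ] at h1
  have hz : 0 < ‖z‖^n := pow_pos (norm_pos_iff.2 h3) n
  have : ‖b‖ * ‖z‖^n ≤ (C * ‖z‖) * ‖z‖^n := by linarith
  exact absurd (le_of_mul_le_mul_right this hz) (not_le.2 h2)

lemma aux_int (p c : ℂ) :
    ∫ t in (0:ℝ)..1, (1 + (1/2 - (t:ℂ)) * p + ((t:ℂ)^2 - (t:ℂ)/2 - 1/12) * p^2
      + ((t:ℂ)/2 - (t:ℂ)^2/2) * c) = 1 + c / 12 := by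
  have key : ∀ s : ℂ, HasDerivAt (fun s : ℂ => s + (s/2 - s^2/2) * p
      + (s^3/3 - s^2/4 - s/12) * p^2 + (s^2/4 - s^3/6) * c)
      (1 + (1/2 - s) * p + (s^2 - s/2 - 1/12) * p^2 + (s/2 - s^2/2) * c) s := by
    intro s
    have h1 := hasDerivAt_id' s
    have h2 := hasDerivAt_pow 2 s
    have h3 := hasDerivAt_pow 3 s
    have := ((h1.fun_add (((h1.div_const 2).fun_sub (h2.div_const 2)).mul_const p)).fun_add
      ((((h3.div_const 3).fun_sub (h2.div_const 4)).fun_sub (h1.div_const 12)).mul_const (p^2))).fun_add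
      (((h2.div_const 4).fun_sub (h3.div_const 6)).mul_const c)
    refine HasDerivAt.congr_deriv this ?_
    norm_num; ring
  rw [intervalIntegral.integral_eq_sub_of_hasDerivAt (fun t _ => (key t).comp_ofReal)]
  · push_cast; ring
  · exact Continuous.intervalIntegrable (by fun_prop) _ _

lemma aux_L (α : Type*) (l : Filter α) (Y : α → ℂ) (hY : Tendsto Y l (𝓝 0))
    (hne : ∀ᶠ x in l, Y x ≠ 0) :
    (fun x => log (1 + Y x) / Y x - (1 - Y x / 2 + Y x^2/3)) =O[l] fun x => Y x^3 := by
  obtain ⟨C, hC⟩ := ((log_sub_logTaylor_isBigO 3).comp_tendsto hY).bound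
  refine IsBigO.of_bound C ?_
  filter_upwards [hC, hne] with x hx h0
  have hp : 0 < ‖Y x‖ := norm_pos_iff.2 h0
  simp only [Function.comp, logTaylor, Finset.sum_range_succ, Finset.sum_range_zero] at hx
  have e : log (1 + Y x) / Y x - (1 - Y x / 2 + Y x^2/3) =
    (log (1 + Y x) - (Y x - Y x^2/2 + Y x^3/3)) / Y x := by field_simp
  rw [e, norm_div, div_le_iff₀ hp]
  refine le_trans (le_of_eq ?_) (hx.trans (le_of_eq ?_))
  · congr 1; norm_num; ring
  · rw [norm_pow, norm_pow]; ring

lemma aux_main (f Δ : ℂ → ℂ) (a : ℂ) (m : ℕ) (ha : a ≠ 0)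
    (r : ℝ) (hr : 0 < r) (hf : DifferentiableOn ℂ f (ball 0 r))
    (hre : ∀ z ∈ ball (0:ℂ) r, 0 < (deriv f z).re)
    (hΔf : Δ = fun z => f z - z)
    (hexp : (fun z => Δ z - a * z^(m+2)) =O[𝓝 0] fun z => z^(m+3))
    (W : ℂ → ℂ) (hW : W = fun s => (deriv f s - 1) / ((f s - s) * log (deriv f s)))
    (u : ℂ → ℂ) (hu : ∀ z, u z = -1 + Δ z * ∫ t in (0:ℝ)..1, W (z + t * Δ z)) :
    (∀ᶠ z in 𝓝[≠] (0:ℂ), DifferentiableAt ℂ u z) ∧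
      (fun z => u z - (1/12) * a^2 * ((m : ℂ) + 1) * ((m : ℂ) + 2) * z^(2*m+2))
        =O[𝓝[≠] 0] fun z => z^(2*m+3) := by
  have hfA : AnalyticAt ℂ f 0 := hf.analyticAt (ball_mem_nhds _ hr)
  have hΔ : AnalyticAt ℂ Δ 0 := by rw [hΔf]; fun_prop
  have hΔd : ∀ z ∈ ball (0:ℂ) r, deriv Δ z = deriv f z - 1 := by
    intro z hz
    have := (hf.differentiableAt (isOpen_ball.mem_nhds hz)).hasDerivAt.fun_sub (hasDerivAt_id' z)
    rw [hΔf]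
    exact this.deriv
  -- derivative asymptotics
  have hR : AnalyticAt ℂ (fun z => Δ z - a * z^(m+2)) 0 := by fun_prop
  have r1 := aux_derivO _ (m+2) hR hexp
  have e1 : deriv (fun z => Δ z - a * z^(m+2)) =ᶠ[𝓝 0]
      fun z => deriv Δ z - (a * (m+2)) * z^(m+1) := by
    filter_upwards [hΔ.eventually_analyticAt] with z hz
    have := (hz.differentiableAt.hasDerivAt.fun_sub
      ((hasDerivAt_pow (m+2) z).const_mul a)).deriv
    rw [this]; push_cast; ring_nf
  have r1' : (fun z => deriv Δ z - (a * (m+2)) * z^(m+1)) =O[𝓝 0] fun z => z^(m+2) :=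
    r1.congr' e1 EventuallyEq.rfl
  have hΔ' := hΔ.deriv
  have hR' : AnalyticAt ℂ (fun z => deriv Δ z - (a * (m+2)) * z^(m+1)) 0 := by fun_prop
  have r2 := aux_derivO _ (m+1) hR' r1'
  have e2 : deriv (fun z => deriv Δ z - (a * (m+2)) * z^(m+1)) =ᶠ[𝓝 0]
      fun z => deriv (deriv Δ) z - (a * (m+2) * (m+1)) * z^m := by
    filter_upwards [hΔ'.eventually_analyticAt] with z hz
    have := (hz.differentiableAt.hasDerivAt.fun_sub
      ((hasDerivAt_pow (m+1) z).const_mul (a * (m+2)))).deriv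
    rw [this]; push_cast; ring_nf
  have r2' : (fun z => deriv (deriv Δ) z - (a * (m+2) * (m+1)) * z^m) =O[𝓝 0] fun z => z^(m+1) :=
    r2.congr' e2 EventuallyEq.rfl
  have hpow : ∀ i j : ℕ, j ≤ i → (fun z : ℂ => z^i) =O[𝓝 0] fun z => z^j := by
    intro i j hij
    obtain ⟨k, rfl⟩ := Nat.exists_eq_add_of_le hij
    have h1 : (fun z : ℂ => z^k) =O[𝓝 0] fun _ => (1:ℂ) :=
      ((continuous_pow k).tendsto (0:ℂ)).isBigO_one ℂ
    simpa [pow_add] using (isBigO_refl (fun z : ℂ => z^j) (𝓝 0)).mul h1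
  have b0 : Δ =O[𝓝 0] fun z => z^(m+2) := by
    refine ((hexp.trans (hpow _ _ (by omega))).add
      ((isBigO_refl (fun z : ℂ => z^(m+2)) (𝓝 0)).const_mul_left a)).congr_left fun z => ?_
    ring
  have b1 : deriv Δ =O[𝓝 0] fun z => z^(m+1) := by
    refine ((r1'.trans (hpow _ _ (by omega))).add
      ((isBigO_refl (fun z : ℂ => z^(m+1)) (𝓝 0)).const_mul_left (a * (m+2)))).congr_left fun z => ?_
    ring
  have b2 : deriv (deriv Δ) =O[𝓝 0] fun z => z^m := by
    refine ((r2'.trans (hpow _ _ (by omega))).add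
      ((isBigO_refl (fun z : ℂ => z^m) (𝓝 0)).const_mul_left (a * (m+2) * (m+1)))).congr_left
      fun z => ?_
    ring
  have bc : (fun z => Δ z * deriv (deriv Δ) z - a^2 * (m+1) * (m+2) * z^(2*m+2))
      =O[𝓝 0] fun z => z^(2*m+3) := by
    have h1 := (hexp.mul b2)
    have h2 := (((isBigO_refl (fun z : ℂ => z^(m+2)) (𝓝 0)).const_mul_left a)).mul r2'
    have h1' := h1.congr_right (g₂ := fun z : ℂ => z^(2*m+3)) (fun z => by ring)
    have h2' := h2.congr_right (g₂ := fun z : ℂ => z^(2*m+3)) (fun z => by ring)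
    refine (h1'.add h2').congr_left fun z => ?_
    ring
  have hm2 : ((m:ℂ) + 2) ≠ 0 := by exact_mod_cast (by omega : m + 2 ≠ 0)
  have n0 := aux_ne Δ a (m+2) ha hexp
  have n1 := aux_ne (deriv Δ) (a * (m+2)) (m+1) (mul_ne_zero ha hm2) r1'
  have small : ∀ᶠ z in 𝓝 (0:ℂ), ‖Δ z‖ ≤ 1/2 * ‖z‖ := by
    have : Δ =o[𝓝 0] fun z => z := by
      refine b0.trans_isLittleO ?_
      simpa using isLittleO_pow_pow (𝕜 := ℂ) (m := 1) (n := m+2) (by omega)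
    exact this.bound (by norm_num)
  obtain ⟨ρ₁, hρ₁, hn⟩ := Metric.eventually_nhds_iff.1
    ((eventually_nhdsWithin_iff.1 (n0.and n1)).and small)
  obtain ⟨ρ, hρ, hρr, hρρ⟩ : ∃ ρ > 0, ρ ≤ r ∧ ρ ≤ ρ₁ :=
    ⟨min r ρ₁, lt_min hr hρ₁, min_le_left _ _, min_le_right _ _⟩
  set V : Set ℂ := ball 0 ρ \ {0} with hVd
  set U : Set ℂ := ball 0 (ρ/2) \ {0} with hUd
  have hV : IsOpen V := isOpen_ball.sdiff isClosed_singleton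
  have hU : IsOpen U := isOpen_ball.sdiff isClosed_singleton
  have hUV : U ⊆ V := sdiff_subset_sdiff_left (ball_subset_ball (by linarith))
  have hVr : V ⊆ ball 0 r := sdiff_subset.trans (ball_subset_ball hρr)
  have hVn : ∀ z ∈ V, Δ z ≠ 0 ∧ deriv Δ z ≠ 0 := fun z hz =>
    (hn (lt_of_lt_of_le (mem_ball.1 hz.1) hρρ)).1 hz.2
  have hmap : ∀ z ∈ U, ∀ t ∈ Icc (0:ℝ) 1, z + t * Δ z ∈ V ∧ ‖z + t * Δ z‖ ≤ 2 * ‖z‖ ∧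
      ‖t * Δ z‖ ≤ ‖Δ z‖ ∧ ‖t * Δ z‖ ≤ ‖z‖ := by
    intro z hz t ht
    have h1 : ‖Δ z‖ ≤ 1/2 * ‖z‖ :=
      (hn (lt_of_lt_of_le (mem_ball.1 (hUV hz).1) hρρ)).2
    have h2 : ‖(t:ℂ) * Δ z‖ ≤ ‖Δ z‖ := by
      rw [norm_mul, Complex.norm_real, Real.norm_of_nonneg ht.1]
      exact mul_le_of_le_one_left (norm_nonneg _) ht.2
    have h3 : ‖z‖ < ρ/2 := by simpa using hz.1
    have h4 : 0 < ‖z‖ := norm_pos_iff.2 hz.2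
    have h5 := norm_add_le z (t * Δ z)
    refine ⟨⟨?_, ?_⟩, by linarith, h2, by linarith⟩
    · rw [mem_ball_zero_iff]; linarith
    · intro h0
      have h0' : z + t * Δ z = 0 := h0
      have : z = -(t * Δ z) := eq_neg_of_add_eq_zero_left h0'
      have : ‖z‖ = ‖(t:ℂ) * Δ z‖ := by rw [← norm_neg ((t:ℂ) * Δ z), ← this]
      linarith
  have hΔV : DifferentiableOn ℂ Δ V := by
    rw [hΔf]; exact (hf.mono hVr).sub differentiableOn_id
  have hWV : DifferentiableOn ℂ W V := by
    have hd : DifferentiableOn ℂ (deriv f) V := (hf.deriv isOpen_ball).mono hVr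
    have hf' := hf.mono hVr
    rw [hW]
    refine DifferentiableOn.div (hd.sub_const 1) ((hf'.sub differentiableOn_id).mul
      (hd.clog fun z hz => Or.inl (hre z (hVr hz)))) ?_
    intro z hz
    obtain ⟨h1, h2⟩ := hVn z hz
    rw [hΔd z (hVr hz)] at h2
    rw [hΔf] at h1
    refine mul_ne_zero h1 fun h => h2 ?_
    have h0 : deriv f z ≠ 0 := fun h0 => by
      have := hre z (hVr hz); rw [h0] at this; simp at this
    rw [← Complex.exp_log h0, h]; simp
  have hI := aux_param W Δ U V hU hV hWV (hΔV.mono hUV) (fun z hz t ht => (hmap z hz t ht).1)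
  have huU : DifferentiableOn ℂ u U := by
    have : u = fun z => -1 + Δ z * ∫ t in (0:ℝ)..1, W (z + t * Δ z) := funext hu
    rw [this]
    exact (((hΔV.mono hUV).mul hI).const_add (-1))
  have hUm : ∀ᶠ z in 𝓝[≠] (0:ℂ), z ∈ U := by
    rw [eventually_nhdsWithin_iff]
    filter_upwards [ball_mem_nhds (0:ℂ) (half_pos hρ)] with z hz h0
    exact ⟨hz, h0⟩
  refine ⟨hUm.mono fun z hz => huU.differentiableAt (hU.mem_nhds hz), ?_⟩
  -- asymptotics
  obtain ⟨C, δ, hδ, hT⟩ := aux_taylor Δ hΔ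
  set l : Filter (ℂ × ℝ) := 𝓝[≠] (0:ℂ) ×ˢ 𝓟 (Icc (0:ℝ) 1) with hl
  have tf : Tendsto (Prod.fst : ℂ × ℝ → ℂ) l (𝓝[≠] (0:ℂ)) := tendsto_fst
  have tf0 : Tendsto (Prod.fst : ℂ × ℝ → ℂ) l (𝓝 (0:ℂ)) := tf.mono_right nhdsWithin_le_nhds
  have hev : ∀ᶠ x in l, x.1 ∈ U ∧ ‖x.1‖ < δ ∧ x.2 ∈ Icc (0:ℝ) 1 := by
    have h1 := tf.eventually hUm
    have h2 := tf0.eventually (ball_mem_nhds (0:ℂ) hδ)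
    have h3 : ∀ᶠ x in l, x.2 ∈ Icc (0:ℝ) 1 := tendsto_snd.eventually (mem_principal_self _)
    filter_upwards [h1, h2, h3] with x h1 h2 h3
    exact ⟨h1, by simpa using h2, h3⟩
  have b0l := b0.comp_tendsto tf0
  have b1l := b1.comp_tendsto tf0
  have b2l := b2.comp_tendsto tf0
  have hΔ2 : (fun x : ℂ × ℝ => Δ x.1 ^ 2) =O[l] fun x => x.1^(2*m+3) := by
    refine (b0l.pow 2).trans (((hpow (2*m+4) (2*m+3) (by omega)).comp_tendsto tf0).congr_left ?_)
    intro x; simp only [Function.comp]; ring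
  have tz : Tendsto (fun x : ℂ × ℝ => x.1 + x.2 * Δ x.1) l (𝓝 0) := by
    have : (fun x : ℂ × ℝ => x.1 + x.2 * Δ x.1) =O[l] fun x => x.1 := by
      refine IsBigO.of_bound 2 ?_
      filter_upwards [hev] with x hx
      exact (hmap x.1 hx.1 x.2 hx.2.2).2.1
    exact this.trans_tendsto tf0
  have tpow : ∀ k : ℕ, Tendsto (fun z : ℂ => z^(k+1)) (𝓝 0) (𝓝 0) := by
    intro k
    have := (continuous_pow (k+1)).tendsto (0:ℂ)
    rwa [zero_pow (by omega)] at this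
  have tY : Tendsto (fun x : ℂ × ℝ => deriv Δ (x.1 + x.2 * Δ x.1)) l (𝓝 0) :=
    (b1.trans_tendsto (tpow m)).comp tz
  have hmainO := aux_alg (l := l) (p := fun x => deriv Δ x.1)
    (c := fun x => Δ x.1 * deriv (deriv Δ) x.1) (t := fun x => (x.2:ℂ))
    (w := fun x => x.1^(m+1)) (e := fun x => x.1^(2*m+3))
    (A := fun x => Δ (x.1 + x.2 * Δ x.1) / Δ x.1)
    (Y := fun x => deriv Δ (x.1 + x.2 * Δ x.1))
    (L := fun x => log (1 + deriv Δ (x.1 + x.2 * Δ x.1)) / deriv Δ (x.1 + x.2 * Δ x.1))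
    ((tpow m).comp tf0)
    (((hpow (3*(m+1)) (2*m+3) (by omega)).comp_tendsto tf0).congr_left
      (fun x => by simp only [Function.comp]; ring))
    (((hpow (2*m+3) (2*(m+1)) (by omega)).comp_tendsto tf0).congr_right
      (fun x => by simp only [Function.comp]; ring))
    (by
      refine IsBigO.of_bound 1 ?_
      filter_upwards [hev] with x hx
      simp only [Complex.norm_real, Pi.one_apply, norm_one, mul_one]
      rw [Real.norm_of_nonneg hx.2.2.1]; exact hx.2.2.2)
    b1l
    ((b0l.mul b2l).congr_right (fun x => by simp only [Function.comp]; ring))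
    (by
      refine IsBigO.trans (IsBigO.of_bound (|C|) ?_) hΔ2
      filter_upwards [hev] with x hx
      obtain ⟨h1, h2, h3, h4⟩ := hmap x.1 hx.1 x.2 hx.2.2
      have h5 := (hT x.1 (x.2 * Δ x.1) hx.2.1 (by linarith [hx.2.1])).1
      have h0 := (hVn x.1 (hUV hx.1)).1
      have hpos := norm_pos_iff.2 h0
      have e : Δ (x.1 + x.2 * Δ x.1) / Δ x.1 - (1 + x.2 * deriv Δ x.1 +
          (x.2:ℂ)^2 * (Δ x.1 * deriv (deriv Δ) x.1) / 2) =
          (Δ (x.1 + x.2 * Δ x.1) - Δ x.1 - x.2 * Δ x.1 * deriv Δ x.1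
            - (x.2 * Δ x.1)^2/2 * deriv (deriv Δ) x.1) / Δ x.1 := by
        field_simp
        try ring
      rw [e, norm_div, div_le_iff₀ hpos, norm_pow]
      calc _ ≤ C * ‖(x.2:ℂ) * Δ x.1‖^3 := h5
        _ ≤ |C| * ‖Δ x.1‖^3 := by
          gcongr
          exact le_abs_self C
        _ = _ := by ring)
    (by
      refine IsBigO.trans (IsBigO.of_bound (|C|) ?_) hΔ2
      filter_upwards [hev] with x hx
      obtain ⟨h1, h2, h3, h4⟩ := hmap x.1 hx.1 x.2 hx.2.2
      have h5 := (hT x.1 (x.2 * Δ x.1) hx.2.1 (by linarith [hx.2.1])).2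
      rw [norm_pow]
      calc _ = ‖deriv Δ (x.1 + x.2 * Δ x.1) - deriv Δ x.1 - x.2 * Δ x.1 * deriv (deriv Δ) x.1‖ := by
            congr 1; ring
        _ ≤ C * ‖(x.2:ℂ) * Δ x.1‖^2 := h5
        _ ≤ |C| * ‖Δ x.1‖^2 := by
          gcongr
          exact le_abs_self C)
    (aux_L _ l _ tY (by
      filter_upwards [hev] with x hx
      exact (hVn _ (hmap x.1 hx.1 x.2 hx.2.2).1).2))
  obtain ⟨K, hK⟩ := hmainO.bound
  rw [hl, eventually_prod_principal_iff] at hK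
  have hfin : (fun z => u z - Δ z * deriv (deriv Δ) z / 12) =O[𝓝[≠] 0] fun z => z^(2*m+3) := by
    refine IsBigO.of_bound K ?_
    filter_upwards [hK, hUm] with z hz hzU
    rw [← sub_add_cancel (u z - Δ z * deriv (deriv Δ) z / 12) 0]
    have hWc : ContinuousOn (fun t : ℝ => Δ z * W (z + t * Δ z)) (Icc 0 1) := by
      refine continuousOn_const.mul (hWV.continuousOn.comp (by fun_prop) ?_)
      intro t ht
      exact (hmap z hzU t ht).1
    have i1 : IntervalIntegrable (fun t : ℝ => Δ z * W (z + t * Δ z)) MeasureTheory.volume 0 1 := by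
      refine ContinuousOn.intervalIntegrable ?_
      rwa [uIcc_of_le zero_le_one]
    have i2 : IntervalIntegrable (fun t : ℝ => (1 + (1/2 - (t:ℂ)) * deriv Δ z
      + ((t:ℂ)^2 - (t:ℂ)/2 - 1/12) * (deriv Δ z)^2
      + ((t:ℂ)/2 - (t:ℂ)^2/2) * (Δ z * deriv (deriv Δ) z))) MeasureTheory.volume 0 1 :=
      Continuous.intervalIntegrable (by fun_prop) _ _
    have e : u z - Δ z * deriv (deriv Δ) z / 12 =
        ∫ t in (0:ℝ)..1, (Δ z * W (z + t * Δ z) - (1 + (1/2 - (t:ℂ)) * deriv Δ z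
      + ((t:ℂ)^2 - (t:ℂ)/2 - 1/12) * (deriv Δ z)^2
      + ((t:ℂ)/2 - (t:ℂ)^2/2) * (Δ z * deriv (deriv Δ) z))) := by
      rw [intervalIntegral.integral_sub i1 i2, aux_int, intervalIntegral.integral_const_mul, hu]
      ring
    rw [sub_zero, add_zero, e]
    have := intervalIntegral.norm_integral_le_of_norm_le_const (a := (0:ℝ)) (b := 1)
      (C := K * ‖z^(2*m+3)‖) (f := fun t : ℝ => (Δ z * W (z + t * Δ z) - (1 + (1/2 - (t:ℂ)) * deriv Δ z
      + ((t:ℂ)^2 - (t:ℂ)/2 - 1/12) * (deriv Δ z)^2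
      + ((t:ℂ)/2 - (t:ℂ)^2/2) * (Δ z * deriv (deriv Δ) z)))) ?_
    · simpa using this
    · intro t ht
      rw [uIoc_of_le zero_le_one] at ht
      have ht' : t ∈ Icc (0:ℝ) 1 := Ioc_subset_Icc_self ht
      have hz2 := hz t ht'
      have hs := hVr (hmap z hzU t ht').1
      have e3 : Δ z * W (z + t * Δ z) = (Δ (z + t * Δ z) / Δ z *
          (log (1 + deriv Δ (z + t * Δ z)) / deriv Δ (z + t * Δ z)))⁻¹ := by
        have h1 : deriv f (z + t * Δ z) = 1 + deriv Δ (z + t * Δ z) := by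
          rw [hΔd _ hs]; ring
        have h2 : f (z + t * Δ z) - (z + t * Δ z) = Δ (z + t * Δ z) := by
          simp only [hΔf]
        have h3 : W (z + t * Δ z) = deriv Δ (z + t * Δ z) /
            (Δ (z + t * Δ z) * log (1 + deriv Δ (z + t * Δ z))) := by
          rw [hW]
          simp only
          rw [h1, h2, add_sub_cancel_left]
        rw [h3, div_mul_div_comm, inv_div]
        ring
      rw [e3]
      exact hz2
  refine (hfin.add ((bc.mono nhdsWithin_le_nhds).const_mul_left (1/12))).congr_left fun z => ?_
  ring

/-- for `f(z) = z + a z^(q+1) + O(z^(q+2))`, `a ≠ 0`, the function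
`u_f(z) = -1 + ∫_{[z,f z]} ω_f(s) ds` (with `ω_f` the Buff form) extends holomorphically
to `0` with `u_f(z) = (1/12) a² q(q+1) z^(2q) + O(z^(2q+1))`; in particular it has a zero
of order exactly `2q` at `0`. -/
theorem u_f_expansion_parabolic
    (f : ℂ → ℂ) (a : ℂ) (q : ℕ) (hq : 1 ≤ q) (ha : a ≠ 0)
    (r : ℝ) (hr : 0 < r) (hf : DifferentiableOn ℂ f (ball 0 r))
    (hre : ∀ z ∈ ball (0:ℂ) r, 0 < (deriv f z).re)
    (hexp : (fun z => f z - z - a * z^(q+1)) =O[𝓝 0] fun z => z^(q+2))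
    (u : ℂ → ℂ)
    (hu : ∀ z, u z = -1 + (f z - z) *
      ∫ t in (0:ℝ)..1,
        (deriv f ((1 - (t:ℂ)) * z + (t:ℂ) * f z) - 1) /
          ((f ((1 - (t:ℂ)) * z + (t:ℂ) * f z) - ((1 - (t:ℂ)) * z + (t:ℂ) * f z)) *
            Complex.log (deriv f ((1 - (t:ℂ)) * z + (t:ℂ) * f z)))) :
    ∃ g : ℂ → ℂ, AnalyticAt ℂ g 0 ∧ (∀ᶠ z in 𝓝[≠] (0:ℂ), g z = u z) ∧
      (fun z => g z - (1/12) * a^2 * (q : ℂ) * ((q : ℂ) + 1) * z^(2*q))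
        =O[𝓝 0] fun z => z^(2*q+1) := by
  obtain ⟨m, rfl⟩ : ∃ m, q = m + 1 := ⟨q - 1, by omega⟩
  obtain ⟨hd, hO⟩ := aux_main f (fun z => f z - z) a m ha r hr hf hre rfl hexp
    (fun s => (deriv f s - 1) / ((f s - s) * log (deriv f s))) rfl u (by
      intro z
      rw [hu z]
      congr 2
      refine intervalIntegral.integral_congr fun t _ => ?_
      have e : (1 - (t:ℂ)) * z + (t:ℂ) * f z = z + t * (f z - z) := by ring
      simp only [e])
  have hne : ∀ᶠ z in 𝓝[≠] (0:ℂ), Function.update u 0 0 z = u z := by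
    filter_upwards [self_mem_nhdsWithin] with z hz
    exact Function.update_of_ne hz _ _
  have hg : (fun z => Function.update u 0 0 z - (1/12) * a^2 * ((m + 1 : ℕ) : ℂ)
      * (((m + 1 : ℕ) : ℂ) + 1) * z^(2*(m+1))) =O[𝓝 0] fun z => z^(2*(m+1)+1) := by
    obtain ⟨C, hC⟩ := hO.bound
    refine IsBigO.of_bound C ?_
    filter_upwards [eventually_nhdsWithin_iff.1 hC] with z hz
    by_cases h0 : z = 0
    · subst h0; simp
    · rw [Function.update_of_ne h0]
      refine le_trans (le_of_eq ?_) (hz h0)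
      congr 1; push_cast; ring
  refine ⟨Function.update u 0 0, ?_, hne, hg⟩
  refine analyticAt_of_differentiable_on_punctured_nhds_of_continuousAt ?_ ?_
  · filter_upwards [hd, self_mem_nhdsWithin] with z hz h0
    refine hz.congr_of_eventuallyEq ?_
    filter_upwards [isOpen_ne.mem_nhds h0] with y hy
    exact Function.update_of_ne hy _ _
  · have t1 : Tendsto (fun z : ℂ => z^(2*(m+1)+1)) (𝓝 0) (𝓝 0) := by
      have := (continuous_pow (2*(m+1)+1)).tendsto (0:ℂ)
      rwa [zero_pow (by omega)] at this
    have t2 : Tendsto (fun z : ℂ => (1/12) * a^2 * ((m + 1 : ℕ) : ℂ)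
      * (((m + 1 : ℕ) : ℂ) + 1) * z^(2*(m+1))) (𝓝 0) (𝓝 0) := by
      have := ((continuous_pow (2*(m+1))).tendsto (0:ℂ)).const_mul ((1/12) * a^2 * ((m + 1 : ℕ) : ℂ)
        * (((m + 1 : ℕ) : ℂ) + 1))
      rwa [zero_pow (by omega), mul_zero] at this
    have t3 := (hg.trans_tendsto t1).add t2
    have : Tendsto (Function.update u 0 0) (𝓝 (0:ℂ)) (𝓝 0) := by
      rw [add_zero] at t3
      exact t3.congr fun z => by ring
    simpa [ContinuousAt] using this
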